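/- Let n ≥ 2, let E and F be complex Banach spaces, and let M : Eⁿ → F be a continuous symmetric n-linear map. Then for all a, b ∈ E, ‖M(a,…,a,b)‖ ≤ (n/(n−1))^{n−1} · ‖a‖^{n−1} · ‖b‖ · sup_{‖y‖≤1} ‖M(y,…,y)‖ ≤ e · ‖a‖^{n−1} · ‖b‖ · sup_{‖y‖≤1} ‖M(y,…,y)‖, where M(a,…,a,b) denotes evaluation at n−1 copies of a and one copy of b. -/

import Mathlib

open Finset

/-- The sup norm of a (polynomial) map on the closed unit ball. -/
noncomputable def polyNorm {E F : Type*} [NormedAddCommGroup E] [NormedSpace ℂ E]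
    [NormedAddCommGroup F] [NormedSpace ℂ F] (P : E → F) : ℝ :=
  ⨆ x : (Metric.closedBall (0 : E) 1), ‖P x.1‖

section Polarization

variable {E F : Type*} [NormedAddCommGroup E] [NormedSpace ℂ E]
  [NormedAddCommGroup F] [NormedSpace ℂ F] {n : ℕ}

lemma polyNorm_nonneg (P : E → F) : 0 ≤ polyNorm P :=
  Real.iSup_nonneg fun _ => norm_nonneg _

lemma norm_diag_le_polyNorm (M : ContinuousMultilinearMap ℂ (fun _ : Fin n => E) F)
    {y : E} (hy : ‖y‖ ≤ 1) : ‖M fun _ => y‖ ≤ polyNorm fun y => M fun _ => y := by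
  have hbdd : BddAbove (Set.range fun x : Metric.closedBall (0 : E) 1 => ‖M fun _ => x.1‖) := by
    refine ⟨‖M‖, ?_⟩
    rintro _ ⟨⟨x, hx⟩, rfl⟩
    have hx' : ‖x‖ ≤ 1 := by simpa using hx
    simpa using M.le_opNorm_mul_pow_of_le
      (m := fun _ => x) (b := 1) ((pi_norm_le_iff_of_nonneg zero_le_one).2 fun _ => hx')
  exact le_ciSup hbdd ⟨y, by simpa using hy⟩

lemma norm_diag_le_polyNorm_mul_pow (M : ContinuousMultilinearMap ℂ (fun _ : Fin n => E) F)
    {y : E} {R : ℝ} (hR : 0 < R) (hy : ‖y‖ ≤ R) :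
    ‖M fun _ => y‖ ≤ R ^ n * polyNorm fun y => M fun _ => y := by
  have hRy : ‖(R : ℂ)⁻¹ • y‖ ≤ 1 := by
    rw [norm_smul, norm_inv, Complex.norm_real, Real.norm_of_nonneg hR.le]
    exact inv_mul_le_one_of_le₀ hy hR.le
  have hscale : (M fun _ => y) = (R : ℂ) ^ n • M fun _ => (R : ℂ)⁻¹ • y := by
    have h := M.map_smul_univ (fun _ => (R : ℂ)) fun _ => (R : ℂ)⁻¹ • y
    simpa [smul_smul, hR.ne'] using h
  rw [hscale, norm_smul, norm_pow, Complex.norm_real, Real.norm_of_nonneg hR.le]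
  gcongr
  exact norm_diag_le_polyNorm M hRy

/-- The derivative of `z ↦ M(a + z b, …, a + z b)` at `0` is `n M(a, …, a, b)`. -/
lemma hasDerivAt_diag_line (hn : 0 < n)
    (M : ContinuousMultilinearMap ℂ (fun _ : Fin n => E) F)
    (hM : ∀ (v : Fin n → E) (σ : Equiv.Perm (Fin n)), M (v ∘ σ) = M v) (a b : E) :
    HasDerivAt (fun z : ℂ => M fun _ => a + z • b)
      ((n : ℂ) • M fun i => if (i : ℕ) < n - 1 then a else b) 0 := by
  have hline : HasDerivAt (fun z : ℂ => a + z • b) b 0 := by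
    simpa using ((hasDerivAt_id (0 : ℂ)).smul_const b).const_add a
  have h := (HasFDerivAt.multilinear_comp M fun _ : Fin n => hline.hasFDerivAt).hasDerivAt
  refine h.congr_deriv ?_
  have hlast : (fun i : Fin n => if (i : ℕ) < n - 1 then a else b) =
      Function.update (fun _ => a) ⟨n - 1, by lia⟩ b := by
    ext i
    by_cases hi : i = ⟨n - 1, by lia⟩
    · simp [hi]
    · have : (i : ℕ) < n - 1 := by
        have := i.2
        have : (i : ℕ) ≠ n - 1 := fun h => hi (Fin.ext h)
        lia
      simp [hi, this]
  have hterm (i : Fin n) : M (Function.update (fun _ => a) i b) =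
      M fun i => if (i : ℕ) < n - 1 then a else b := by
    rw [hlast, ← hM _ (Equiv.swap i ⟨n - 1, by lia⟩)]
    congr 1
    ext j
    simp only [Function.comp_apply, Function.update_apply, Equiv.swap_apply_def]
    grind
  simp [hterm, ContinuousMultilinearMap.toContinuousLinearMap, ← Nat.cast_smul_eq_nsmul ℂ]

/-- Cauchy's estimate on the circle of radius `r`. -/
lemma mul_norm_symm_apply_le (hn : 0 < n)
    (M : ContinuousMultilinearMap ℂ (fun _ : Fin n => E) F)
    (hM : ∀ (v : Fin n → E) (σ : Equiv.Perm (Fin n)), M (v ∘ σ) = M v)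
    (a b : E) {r : ℝ} (hr : 0 < r) (hab : 0 < ‖a‖ + r * ‖b‖) :
    n * ‖M fun i => if (i : ℕ) < n - 1 then a else b‖ ≤
      (‖a‖ + r * ‖b‖) ^ n * polyNorm (fun y => M fun _ => y) / r := by
  have hdiff : Differentiable ℂ fun z : ℂ => M fun _ => a + z • b := fun z =>
    (HasFDerivAt.multilinear_comp M fun _ : Fin n =>
      (((hasDerivAt_id z).smul_const b).const_add a).hasFDerivAt).differentiableAt
  have h := Complex.norm_deriv_le_of_forall_mem_sphere_norm_le (c := 0) hr hdiff.diffContOnCl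
    (C := (‖a‖ + r * ‖b‖) ^ n * polyNorm fun y => M fun _ => y) fun z hz => by
      refine norm_diag_le_polyNorm_mul_pow M hab ((norm_add_le _ _).trans ?_)
      rw [norm_smul, mem_sphere_zero_iff_norm.1 hz]
  rwa [(hasDerivAt_diag_line hn M hM a b).deriv, norm_smul, Complex.norm_natCast] at h

end Polarization

lemma div_sub_one_pow_le_exp_one {n : ℕ} (hn : 2 ≤ n) :
    ((n : ℝ) / ((n : ℝ) - 1)) ^ (n - 1) ≤ Real.exp 1 := by
  obtain ⟨m, rfl⟩ : ∃ m, n = m + 1 := ⟨n - 1, by lia⟩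
  have hm : (0 : ℝ) < m := by exact_mod_cast (by lia : 0 < m)
  calc ((m + 1 : ℕ) / (((m + 1 : ℕ) : ℝ) - 1)) ^ (m + 1 - 1) = ((1 : ℝ) / m + 1) ^ m := by
        push_cast
        rw [add_sub_cancel_right, add_div, div_self hm.ne', add_comm]
    _ ≤ Real.exp (1 / m) ^ m := by gcongr; exact Real.add_one_le_exp _
    _ = Real.exp 1 := by rw [← Real.exp_nat_mul]; congr 1; field_simp

/-- For a continuous symmetric `n`-linear map `M : Eⁿ → F` and `a, b ∈ E`,
`‖M(a,…,a,b)‖ ≤ (n/(n-1))^(n-1) ‖a‖^(n-1) ‖b‖ ‖y ↦ M(y,…,y)‖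
             ≤ e ‖a‖^(n-1) ‖b‖ ‖y ↦ M(y,…,y)‖`. -/
theorem norm_symm_multilinear_apply_le
    {E F : Type*} [NormedAddCommGroup E] [NormedSpace ℂ E] [CompleteSpace E]
    [NormedAddCommGroup F] [NormedSpace ℂ F] [CompleteSpace F]
    (n : ℕ) (hn : 2 ≤ n)
    (M : ContinuousMultilinearMap ℂ (fun _ : Fin n => E) F)
    (hM : ∀ (v : Fin n → E) (σ : Equiv.Perm (Fin n)), M (v ∘ σ) = M v)
    (a b : E) :
    ‖M fun i => if (i : ℕ) < n - 1 then a else b‖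
        ≤ ((n : ℝ) / ((n : ℝ) - 1)) ^ (n - 1) * ‖a‖ ^ (n - 1) * ‖b‖ *
            polyNorm (fun y => M fun _ => y) ∧
      ((n : ℝ) / ((n : ℝ) - 1)) ^ (n - 1) * ‖a‖ ^ (n - 1) * ‖b‖ *
            polyNorm (fun y => M fun _ => y)
        ≤ Real.exp 1 * ‖a‖ ^ (n - 1) * ‖b‖ * polyNorm (fun y => M fun _ => y) := by
  have hP := polyNorm_nonneg (fun y => M fun _ => y)
  have hn1 : (0 : ℝ) < n - 1 := by
    have : (2 : ℝ) ≤ n := by exact_mod_cast hn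
    linarith
  refine ⟨?_, by gcongr; exact div_sub_one_pow_le_exp_one hn⟩
  rcases eq_or_ne a 0 with rfl | ha
  · rw [M.map_coord_zero ⟨0, by lia⟩ (by simp [show 0 < n - 1 by lia])]
    simp only [norm_zero]
    positivity
  rcases eq_or_ne b 0 with rfl | hb
  · rw [M.map_coord_zero ⟨n - 1, by lia⟩ (by simp)]
    simp
  have ha' : 0 < ‖a‖ := norm_pos_iff.2 ha
  have hb' : 0 < ‖b‖ := norm_pos_iff.2 hb
  have h := mul_norm_symm_apply_le (by lia) M hM a b
    (r := ‖a‖ / ((n - 1) * ‖b‖)) (by positivity) (by positivity)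
  have hn0 : (0 : ℝ) < n := by linarith
  refine le_of_mul_le_mul_left (h.trans_eq ?_) hn0
  have hsum : ‖a‖ + ‖a‖ / (((n : ℝ) - 1) * ‖b‖) * ‖b‖ = n / (n - 1) * ‖a‖ := by
    field_simp
    ring
  have hpow (x : ℝ) : x ^ n = x ^ (n - 1) * x := by
    rw [← pow_succ, Nat.sub_add_cancel (by lia)]
  rw [hsum, hpow, mul_pow]
  field_simp
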